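/- Let n ≥ 1, X, Y complex Banach spaces, and U : X → Y a nonzero bounded linear operator with ‖U‖ < λ, where λ > 1, 1 ≤ p < ∞ and 1 ≤ q ≤ ∞. Set C := max{ ((λ^p − ‖U‖^p)/(2λ^p − ‖U‖^p))^{1/p}, ((λ^p − ‖U‖^p)/(λ^p − ‖U‖^p + 1))^{1/p}·(1/‖U‖) } if ‖U‖ ≥ 1, and C := max{ ((λ^p − ‖U‖^p)/(2λ^p − ‖U‖^p))^{1/p}, ((λ^p − ‖U‖^p)/(λ^p − ‖U‖^p + 1))^{1/p} } if 0 < ‖U‖ < 1. Then B_λ(B_{ℓⁿ_q},p,U) ≥ C · n^{−(1/p + 1/q)} (with 1/q := 0 when q = ∞). -/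

import Mathlib

open scoped ENNReal Pointwise
open Filter

noncomputable section

namespace BohrPaper

/-- The monomial `z^α = z₁^{α₁} ⋯ z_n^{α_n}`. -/
def mpow {n : ℕ} (z : Fin n → ℂ) (α : Fin n → ℕ) : ℂ := ∏ j, z j ^ α j

/-- A complete Reinhardt domain in `ℂⁿ`: nonempty, open, connected and closed under
componentwise decrease of moduli. -/
def IsCompleteReinhardt {n : ℕ} (Ω : Set (Fin n → ℂ)) : Prop :=
  IsOpen Ω ∧ IsConnected Ω ∧
    ∀ z ∈ Ω, ∀ w : Fin n → ℂ, (∀ j, ‖w j‖ ≤ ‖z j‖) → w ∈ Ω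

/-- `S(Ω₁, Ω₂) := inf {s > 0 : Ω₁ ⊆ s·Ω₂}`. -/
def SRatio {n : ℕ} (Ω₁ Ω₂ : Set (Fin n → ℂ)) : ℝ :=
  sInf {s : ℝ | 0 < s ∧ Ω₁ ⊆ s • Ω₂}

/-- The open unit polydisc `𝔻ⁿ`. -/
def polydisc (n : ℕ) : Set (Fin n → ℂ) := {z | ∀ j, ‖z j‖ < 1}

/-- The sup-norm of `f` over `Ω`. -/
def supNorm {n : ℕ} {E : Type*} [Norm E] (Ω : Set (Fin n → ℂ)) (f : (Fin n → ℂ) → E) : ℝ :=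
  ⨆ z ∈ Ω, ‖f z‖

/-- The `ℓ_q`-norm on `ℂⁿ` (`q = ∞` gives the max norm). -/
def lqNorm (n : ℕ) (q : ℝ≥0∞) (z : Fin n → ℂ) : ℝ :=
  if q = ∞ then ⨆ j, ‖z j‖
  else (∑ j, ‖z j‖ ^ q.toReal) ^ (1 / q.toReal)

/-- The open unit ball of `ℓⁿ_q`. -/
def lqBall (n : ℕ) (q : ℝ≥0∞) : Set (Fin n → ℂ) := {z | lqNorm n q z < 1}

/-- `N` is a norm on `ℂⁿ`. -/
def IsNorm {n : ℕ} (N : (Fin n → ℂ) → ℝ) : Prop :=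
  (∀ z, 0 ≤ N z) ∧ (∀ z, N z = 0 → z = 0) ∧
    (∀ (c : ℂ) (z), N (c • z) = ‖c‖ * N z) ∧ ∀ z w, N (z + w) ≤ N z + N w

/-- The canonical basis of `ℂⁿ` is normalized and 1-unconditional for the norm `N`. -/
def IsNormalized1Unconditional {n : ℕ} (N : (Fin n → ℂ) → ℝ) : Prop :=
  (∀ k, N (fun j => if j = k then 1 else 0) = 1) ∧
    ∀ ε μ : Fin n → ℂ, (∀ j, ‖ε j‖ ≤ 1) → N (fun j => ε j * μ j) ≤ N μ

/-- Open unit ball of the norm `N`. -/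
def unitBall {n : ℕ} (N : (Fin n → ℂ) → ℝ) : Set (Fin n → ℂ) := {z | N z < 1}

/-- Operator norm of the identity map `(ℂⁿ, N₁) → (ℂⁿ, N₂)`. -/
def idNorm {n : ℕ} (N₁ N₂ : (Fin n → ℂ) → ℝ) : ℝ :=
  sInf {c : ℝ | 0 ≤ c ∧ ∀ z, N₂ z ≤ c * N₁ z}

/-- `b_m(Ω) = (inf_{|α| = m} sup_{z ∈ Ω} |z^α|)^{-1/m}`. -/
def bCoef {n : ℕ} (Ω : Set (Fin n → ℂ)) (m : ℕ) : ℝ :=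
  (sInf ((fun α : Fin n → ℕ => ⨆ z ∈ Ω, ‖mpow z α‖) ''
      {α : Fin n → ℕ | ∑ j, α j = m})) ^ (-(1 / (m : ℝ)))

section Holomorphic

variable {n : ℕ} {X : Type*} [NormedAddCommGroup X] [NormedSpace ℂ X]
  {Y : Type*} [NormedAddCommGroup Y] [NormedSpace ℂ Y]

/-- `f` is a bounded holomorphic `X`-valued function on `Ω` with monomial expansion
`f = Σ a_α z^α` converging locally uniformly on `Ω`. -/
def IsBddHolomorphic (Ω : Set (Fin n → ℂ)) (f : (Fin n → ℂ) → X)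
    (a : (Fin n → ℕ) → X) : Prop :=
  TendstoLocallyUniformlyOn
    (fun (s : Finset (Fin n → ℕ)) z => ∑ α ∈ s, mpow z α • a α) f atTop Ω ∧
  BddAbove ((fun z => ‖f z‖) '' Ω)

/-- The left-hand side `Σ_α sup_{z ∈ rΩ} ‖U a_α‖^p |z^α|^p` of the second Bohr inequality
for holomorphic functions, valued in `ℝ≥0∞`. -/
def holBohrSum (Ω : Set (Fin n → ℂ)) (r p : ℝ) (U : X →L[ℂ] Y)
    (a : (Fin n → ℕ) → X) : ℝ≥0∞ :=
  ∑' α : Fin n → ℕ, ⨆ z ∈ r • Ω,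
    ENNReal.ofReal (‖U (a α)‖ ^ p * ‖mpow z α‖ ^ p)

/-- The second `λ`-powered Bohr radius `B_λ(Ω, p, U)` for holomorphic functions. -/
def secondBohrHol (Ω : Set (Fin n → ℂ)) (p lam : ℝ) (U : X →L[ℂ] Y) : ℝ :=
  sSup {r : ℝ | r ∈ Set.Icc (0 : ℝ) 1 ∧
    ∀ (f : (Fin n → ℂ) → X) (a : (Fin n → ℕ) → X), IsBddHolomorphic Ω f a →
      holBohrSum Ω r p U a ≤ ENNReal.ofReal (lam ^ p * supNorm Ω f ^ p)}

/-- The first `λ`-powered Bohr radius `K_λ(Ω, p, U)` for holomorphic functions. -/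
def firstBohrHol (Ω : Set (Fin n → ℂ)) (p lam : ℝ) (U : X →L[ℂ] Y) : ℝ :=
  sSup {r : ℝ | r ∈ Set.Icc (0 : ℝ) 1 ∧
    ∀ (f : (Fin n → ℂ) → X) (a : (Fin n → ℕ) → X), IsBddHolomorphic Ω f a →
      (⨆ z ∈ r • Ω, ∑' α : Fin n → ℕ,
        ENNReal.ofReal (‖U (a α)‖ ^ p * ‖mpow z α‖ ^ p)) ≤
        ENNReal.ofReal (lam ^ p * supNorm Ω f ^ p)}

end Holomorphic

section CauchyEstimate

/-- Orthogonality of the characters of the group of `N`-th roots of unity. -/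
theorem sum_rootsOfUnity_pow {N : ℕ} {ω : ℂ} (hω : IsPrimitiveRoot ω N) {a b : ℕ}
    (ha : a < N) (hb : b < N) :
    ∑ k : Fin N, (ω ^ (k : ℕ)) ^ (N - a + b) = if b = a then (N : ℂ) else 0 := by
  have hpow : ∀ k : Fin N, (ω ^ (k : ℕ)) ^ (N - a + b) = (ω ^ (N - a + b)) ^ (k : ℕ) := by
    intro k
    rw [← pow_mul, ← pow_mul, mul_comm]
  simp only [hpow]
  split_ifs with h
  · subst h
    rw [Nat.sub_add_cancel ha.le, hω.pow_eq_one]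
    simp
  · have hne : ω ^ (N - a + b) ≠ 1 := by
      intro h1
      obtain ⟨c, hc⟩ := hω.dvd_of_pow_eq_one _ h1
      have hc0 : c ≠ 0 := by
        rintro rfl
        omega
      have hc1 : c < 2 := by
        by_contra! h2
        have := Nat.mul_le_mul_left N h2
        omega
      have : c = 1 := by omega
      subst this
      omega
    rw [Fin.sum_univ_eq_sum_range (fun k => (ω ^ (N - a + b)) ^ k), geom_sum_eq hne,
      ← pow_mul, mul_comm, pow_mul, hω.pow_eq_one]
    simp

variable {n : ℕ}

theorem norm_le_supNorm {E : Type*} [NormedAddCommGroup E] {Ω : Set (Fin n → ℂ)}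
    {f : (Fin n → ℂ) → E}
    (hf : BddAbove ((fun z => ‖f z‖) '' Ω)) {z : Fin n → ℂ} (hz : z ∈ Ω) :
    ‖f z‖ ≤ supNorm Ω f := by
  obtain ⟨B, hB⟩ := hf
  have hB0 : 0 ≤ B := (norm_nonneg _).trans (hB ⟨z, hz, rfl⟩)
  have hbdd : BddAbove (Set.range fun z => ⨆ _ : z ∈ Ω, ‖f z‖) := by
    refine ⟨B, ?_⟩
    rintro _ ⟨w, rfl⟩
    exact Real.iSup_le (fun hw => hB ⟨w, hw, rfl⟩) hB0
  refine le_trans (le_of_eq ?_) (le_ciSup hbdd z)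
  simp [hz]

theorem supNorm_nonneg {E : Type*} [NormedAddCommGroup E]
    (Ω : Set (Fin n → ℂ)) (f : (Fin n → ℂ) → E) : 0 ≤ supNorm Ω f :=
  Real.iSup_nonneg fun _ => Real.iSup_nonneg fun _ => norm_nonneg _

variable {X : Type*} [NormedAddCommGroup X] [NormedSpace ℂ X]

/-- Cauchy estimate for the coefficients of a polynomial bounded on a torus. -/
theorem norm_mpow_mul_norm_le_of_torus_bound (s : Finset (Fin n → ℕ)) (a : (Fin n → ℕ) → X)
    (z : Fin n → ℂ) {B : ℝ}
    (hB : ∀ w : Fin n → ℂ, (∀ j, ‖w j‖ = ‖z j‖) → ‖∑ β ∈ s, mpow w β • a β‖ ≤ B)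
    {α : Fin n → ℕ} (hα : α ∈ s) :
    ‖mpow z α‖ * ‖a α‖ ≤ B := by
  set N : ℕ := (∑ β ∈ s, ∑ j, β j) + 1 with hN
  have hlt : ∀ β ∈ s, ∀ j, β j < N := by
    intro β hβ j
    have h1 : β j ≤ ∑ j, β j :=
      Finset.single_le_sum (f := fun j => β j) (fun _ _ => Nat.zero_le _) (Finset.mem_univ j)
    have h2 : ∑ j, β j ≤ ∑ β ∈ s, ∑ j, β j :=
      Finset.single_le_sum (f := fun β : Fin n → ℕ => ∑ j, β j) (fun _ _ => Nat.zero_le _) hβ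
    omega
  have hN0 : N ≠ 0 := by omega
  obtain ⟨ω, hω⟩ : ∃ ω : ℂ, IsPrimitiveRoot ω N := ⟨_, Complex.isPrimitiveRoot_exp N hN0⟩
  have hω1 : ‖ω‖ = 1 := hω.norm'_eq_one hN0
  let χ : (Fin n → Fin N) → ℂ := fun k => ∏ j, (ω ^ (k j : ℕ)) ^ (N - α j)
  have hχ : ∀ k, ‖χ k‖ = 1 := by
    intro k
    simp [χ, norm_prod, hω1]
  let w : (Fin n → Fin N) → Fin n → ℂ := fun k j => ω ^ (k j : ℕ) * z j
  have horth : ∀ β ∈ s, ∑ k, χ k * mpow (w k) β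
      = if β = α then (N : ℂ) ^ n * mpow z α else 0 := by
    intro β hβ
    have h1 : ∀ k, χ k * mpow (w k) β
        = (∏ j, (ω ^ (k j : ℕ)) ^ (N - α j + β j)) * mpow z β := by
      intro k
      simp only [χ, w, mpow, ← Finset.prod_mul_distrib]
      refine Finset.prod_congr rfl fun j _ => ?_
      rw [mul_pow, pow_add, mul_assoc]
    simp only [h1]
    rw [← Finset.sum_mul,
      ← Fintype.prod_sum (fun (j : Fin n) (k : Fin N) => (ω ^ (k : ℕ)) ^ (N - α j + β j))]
    simp only [sum_rootsOfUnity_pow hω (hlt α hα _) (hlt β hβ _)]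
    split_ifs with h
    · subst h
      simp
    · obtain ⟨j, hj⟩ := Function.ne_iff.mp h
      rw [Finset.prod_eq_zero (Finset.mem_univ j) (if_neg hj), zero_mul]
  have hsum : ∑ k, χ k • ∑ β ∈ s, mpow (w k) β • a β = ((N : ℂ) ^ n * mpow z α) • a α := by
    simp only [Finset.smul_sum, smul_smul]
    rw [Finset.sum_comm]
    simp only [← Finset.sum_smul]
    rw [Finset.sum_eq_single_of_mem α hα]
    · rw [horth α hα, if_pos rfl]
    · intro β hβ hne
      rw [horth β hβ, if_neg hne, zero_smul]
  have hle : ‖((N : ℂ) ^ n * mpow z α) • a α‖ ≤ (N : ℝ) ^ n * B := by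
    rw [← hsum]
    refine (norm_sum_le _ _).trans ?_
    calc ∑ k, ‖χ k • ∑ β ∈ s, mpow (w k) β • a β‖ ≤ ∑ _k : Fin n → Fin N, B := by
          refine Finset.sum_le_sum fun k _ => ?_
          rw [norm_smul, hχ, one_mul]
          exact hB _ fun j => by simp [w, hω1]
      _ = (N : ℝ) ^ n * B := by simp
  rw [norm_smul, norm_mul, norm_pow, Complex.norm_natCast, mul_assoc] at hle
  exact le_of_mul_le_mul_left hle (by positivity)

/-- Cauchy estimate for bounded holomorphic functions on a set invariant under torus rotations. -/
theorem IsBddHolomorphic.norm_mpow_mul_norm_le {Ω : Set (Fin n → ℂ)}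
    (hΩ : ∀ z ∈ Ω, ∀ w : Fin n → ℂ, (∀ j, ‖w j‖ = ‖z j‖) → w ∈ Ω)
    {f : (Fin n → ℂ) → X} {a : (Fin n → ℕ) → X} (hf : IsBddHolomorphic Ω f a)
    {z : Fin n → ℂ} (hz : z ∈ Ω) (α : Fin n → ℕ) :
    ‖mpow z α‖ * ‖a α‖ ≤ supNorm Ω f := by
  classical
  set K : Set (Fin n → ℂ) := Set.univ.pi fun j => Metric.sphere (0 : ℂ) ‖z j‖ with hK
  have hKc : IsCompact K := isCompact_univ_pi fun j => isCompact_sphere _ _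
  have hmem : ∀ w, w ∈ K ↔ ∀ j, ‖w j‖ = ‖z j‖ := by
    intro w
    simp [hK]
  have hKΩ : K ⊆ Ω := fun w hw => hΩ z hz w ((hmem w).1 hw)
  have hunif := (tendstoLocallyUniformlyOn_iff_tendstoUniformlyOn_of_compact hKc).1
    (hf.1.mono hKΩ)
  refine le_of_forall_pos_le_add fun ε hε => ?_
  obtain ⟨s, hs, hαs⟩ := ((Metric.tendstoUniformlyOn_iff.1 hunif ε hε).and
    (eventually_ge_atTop {α})).exists
  refine norm_mpow_mul_norm_le_of_torus_bound s a z (fun w hw => ?_)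
    (Finset.singleton_subset_iff.1 hαs)
  have hwK := (hmem w).2 hw
  have h1 := hs w hwK
  rw [dist_eq_norm, norm_sub_rev] at h1
  have h2 := norm_le_supNorm hf.2 (hKΩ hwK)
  have h3 := norm_sub_norm_le (∑ β ∈ s, mpow w β • a β) (f w)
  linarith

end CauchyEstimate

section BohrSum

variable {n : ℕ}

theorem tsum_prod_pow_eq (n : ℕ) (t : ℝ≥0∞) :
    ∑' α : Fin n → ℕ, ∏ j, t ^ α j = ((1 - t)⁻¹) ^ n := by
  induction n with
  | zero => simp
  | succ n ih =>
    rw [← (Fin.consEquiv fun _ : Fin (n + 1) => ℕ).tsum_eq, ENNReal.tsum_prod', pow_succ', ← ih,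
      ← ENNReal.tsum_geometric, ← ENNReal.tsum_mul_right]
    refine tsum_congr fun k => ?_
    rw [← ENNReal.tsum_mul_left]
    refine tsum_congr fun α => ?_
    simp [Fin.consEquiv, Fin.prod_univ_succ]

theorem mem_lqBall_of_norm_eq {q : ℝ≥0∞} {z w : Fin n → ℂ} (hz : z ∈ lqBall n q)
    (hw : ∀ j, ‖w j‖ = ‖z j‖) : w ∈ lqBall n q := by
  simpa only [lqBall, lqNorm, Set.mem_ofPred_eq, hw] using hz

theorem norm_mpow_smul (r : ℝ) (hr : 0 ≤ r) (z : Fin n → ℂ) (α : Fin n → ℕ) :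
    ‖mpow (r • z) α‖ = (∏ j, r ^ α j) * ‖mpow z α‖ := by
  simp only [mpow, norm_prod, ← Finset.prod_mul_distrib]
  refine Finset.prod_congr rfl fun j _ => ?_
  simp [mul_pow, abs_of_nonneg hr]

variable {X : Type*} [NormedAddCommGroup X] [NormedSpace ℂ X]
  {Y : Type*} [NormedAddCommGroup Y] [NormedSpace ℂ Y]

theorem holBohrSum_le {Ω : Set (Fin n → ℂ)}
    (hΩ : ∀ z ∈ Ω, ∀ w : Fin n → ℂ, (∀ j, ‖w j‖ = ‖z j‖) → w ∈ Ω)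
    {f : (Fin n → ℂ) → X} {a : (Fin n → ℕ) → X} (hf : IsBddHolomorphic Ω f a)
    (U : X →L[ℂ] Y) {r p : ℝ} (hr : 0 ≤ r) (hp : 0 ≤ p) :
    holBohrSum Ω r p U a ≤
      ENNReal.ofReal (‖U‖ ^ p * supNorm Ω f ^ p) * ((1 - ENNReal.ofReal (r ^ p))⁻¹) ^ n := by
  rw [← tsum_prod_pow_eq, ← ENNReal.tsum_mul_left]
  refine ENNReal.tsum_le_tsum fun α => iSup₂_le fun z hz => ?_
  obtain ⟨w, hw, rfl⟩ := hz
  have hM := supNorm_nonneg Ω f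
  have hrp : 0 ≤ r ^ p := Real.rpow_nonneg hr p
  have hprod : (∏ j, ENNReal.ofReal (r ^ p) ^ α j) = ENNReal.ofReal ((∏ j, r ^ α j) ^ p) := by
    rw [← Real.finsetProd_rpow _ _ fun j _ => pow_nonneg hr _,
      ENNReal.ofReal_prod_of_nonneg fun j _ => Real.rpow_nonneg (pow_nonneg hr _) _]
    refine Finset.prod_congr rfl fun j _ => ?_
    rw [← ENNReal.ofReal_pow hrp, Real.rpow_pow_comm hr]
  have hP : 0 ≤ ∏ j, r ^ α j := Finset.prod_nonneg fun j _ => pow_nonneg hr _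
  rw [hprod, ← ENNReal.ofReal_mul (by positivity)]
  refine ENNReal.ofReal_le_ofReal ?_
  rw [← Real.mul_rpow (norm_nonneg _) (norm_nonneg _), ← Real.mul_rpow (norm_nonneg _) hM,
    ← Real.mul_rpow (mul_nonneg (norm_nonneg _) hM) hP]
  refine Real.rpow_le_rpow (by positivity) ?_ hp
  change ‖U (a α)‖ * ‖mpow (r • w) α‖ ≤ _
  rw [norm_mpow_smul r hr]
  calc ‖U (a α)‖ * ((∏ j, r ^ α j) * ‖mpow w α‖)
      ≤ (‖U‖ * ‖a α‖) * ((∏ j, r ^ α j) * ‖mpow w α‖) := by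
        gcongr
        exact U.le_opNorm _
    _ = ‖U‖ * (‖mpow w α‖ * ‖a α‖) * ∏ j, r ^ α j := by ring
    _ ≤ ‖U‖ * supNorm Ω f * ∏ j, r ^ α j := by
        gcongr
        exact hf.norm_mpow_mul_norm_le hΩ hw α

/-- Every radius `r` with `n r^p ≤ 1 - ‖U‖^p / λ^p` is at most the second Bohr radius. -/
theorem le_secondBohrHol {Ω : Set (Fin n → ℂ)}
    (hΩ : ∀ z ∈ Ω, ∀ w : Fin n → ℂ, (∀ j, ‖w j‖ = ‖z j‖) → w ∈ Ω)
    (U : X →L[ℂ] Y) {r p lam : ℝ} (hr : 0 ≤ r) (hr1 : r ≤ 1) (hp : 0 ≤ p) (hlam : 0 < lam)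
    (hU0 : U ≠ 0) (hn : 1 ≤ n) (hrp : n * r ^ p ≤ 1 - ‖U‖ ^ p / lam ^ p) :
    r ≤ secondBohrHol Ω p lam U := by
  refine le_csSup ⟨1, fun x hx => hx.1.2⟩ ⟨⟨hr, hr1⟩, fun f a hf => ?_⟩
  refine (holBohrSum_le hΩ hf U hr hp).trans ?_
  set t := r ^ p with ht
  have ht0 : 0 ≤ t := Real.rpow_nonneg hr p
  have hu : 0 < ‖U‖ ^ p := Real.rpow_pos_of_pos (norm_pos_iff.2 hU0) p
  have hL : 0 < lam ^ p := Real.rpow_pos_of_pos hlam p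
  have huL : 0 < ‖U‖ ^ p / lam ^ p := div_pos hu hL
  have hn' : (1 : ℝ) ≤ n := by exact_mod_cast hn
  have ht1 : t < 1 := by nlinarith
  have hbern : ‖U‖ ^ p / lam ^ p ≤ (1 - t) ^ n := by
    have h := one_add_mul_le_pow (a := -t) (by linarith) n
    rw [← sub_eq_add_neg] at h
    linarith
  have h1t : 0 < 1 - t := by linarith
  have hM : 0 ≤ supNorm Ω f ^ p := Real.rpow_nonneg (supNorm_nonneg Ω f) p
  rw [← ENNReal.ofReal_one, ← ENNReal.ofReal_sub _ ht0, ← ENNReal.ofReal_inv_of_pos h1t,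
    ← ENNReal.ofReal_pow (inv_nonneg.2 h1t.le), ← ENNReal.ofReal_mul (by positivity)]
  refine ENNReal.ofReal_le_ofReal ?_
  rw [inv_pow, ← div_eq_mul_inv, div_le_iff₀ (pow_pos h1t n)]
  rw [div_le_iff₀ hL] at hbern
  calc ‖U‖ ^ p * supNorm Ω f ^ p ≤ ((1 - t) ^ n * lam ^ p) * supNorm Ω f ^ p := by gcongr
    _ = _ := by ring

end BohrSum

/-- lower bound for the second Bohr radius of vector-valued holomorphic
functions on the unit ball of the Minkowski space `ℓⁿ_q`. -/
theorem second_bohr_Hol_lower_bound_lq {n : ℕ} (hn : 1 ≤ n)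
    {X : Type*} [NormedAddCommGroup X] [NormedSpace ℂ X] [CompleteSpace X]
    {Y : Type*} [NormedAddCommGroup Y] [NormedSpace ℂ Y] [CompleteSpace Y]
    (U : X →L[ℂ] Y) (p lam : ℝ) (q : ℝ≥0∞)
    (hp : 1 ≤ p) (hq : 1 ≤ q) (hlam : 1 < lam)
    (hU0 : U ≠ 0) (hU : ‖U‖ < lam)
    (C : ℝ)
    (hC : C = if 1 ≤ ‖U‖ then
        max (((lam ^ p - ‖U‖ ^ p) / (2 * lam ^ p - ‖U‖ ^ p)) ^ (1 / p))
          (((lam ^ p - ‖U‖ ^ p) / (lam ^ p - ‖U‖ ^ p + 1)) ^ (1 / p) * (1 / ‖U‖))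
      else
        max (((lam ^ p - ‖U‖ ^ p) / (2 * lam ^ p - ‖U‖ ^ p)) ^ (1 / p))
          (((lam ^ p - ‖U‖ ^ p) / (lam ^ p - ‖U‖ ^ p + 1)) ^ (1 / p)))
    :
    C * (n : ℝ) ^ (-(1 / p + (1 / q).toReal)) ≤ secondBohrHol (lqBall n q) p lam U := by
  have hp0 : 0 < p := by linarith
  have hlam0 : 0 < lam := by linarith
  have hU1 : 0 < ‖U‖ := norm_pos_iff.2 hU0
  have hu : 0 < ‖U‖ ^ p := Real.rpow_pos_of_pos hU1 p
  have huL : ‖U‖ ^ p < lam ^ p := Real.rpow_lt_rpow hU1.le hU hp0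
  have hUp : (‖U‖ ^ p) ^ (1 / p) = ‖U‖ := by
    rw [one_div, Real.rpow_rpow_inv hU1.le hp0.ne']
  have hone : 1 ≤ ‖U‖ → 1 ≤ ‖U‖ ^ p := fun h => Real.one_le_rpow h hp0.le
  have hone' : ¬ 1 ≤ ‖U‖ → ‖U‖ ^ p ≤ 1 := fun h =>
    Real.rpow_le_one hU1.le (not_le.1 h).le hp0.le
  generalize hLdef : lam ^ p = L at *
  generalize hudef : ‖U‖ ^ p = u at *
  have hL : 0 < L := hu.trans huL
  have hd : 0 < L - u := by linarith
  have hfirst : ((L - u) / (2 * L - u)) ^ (1 / p) ≤ ((L - u) / L) ^ (1 / p) :=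
    Real.rpow_le_rpow (div_nonneg hd.le (by linarith))
      (div_le_div_of_nonneg_left hd.le hL (by linarith)) (by positivity)
  have hfirst0 : 0 ≤ ((L - u) / (2 * L - u)) ^ (1 / p) :=
    Real.rpow_nonneg (div_nonneg hd.le (by linarith)) _
  have hC0 : 0 ≤ C := by
    rw [hC]
    split_ifs
    · exact hfirst0.trans (le_max_left _ _)
    · exact hfirst0.trans (le_max_left _ _)
  have hCD : C ≤ ((L - u) / L) ^ (1 / p) := by
    rw [hC]
    split_ifs with h
    · refine max_le hfirst ?_
      have h1 := hone h
      rw [← hUp, one_div, one_div, ← Real.inv_rpow hu.le,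
        ← Real.mul_rpow (div_nonneg hd.le (by linarith)) (by positivity)]
      refine Real.rpow_le_rpow (by positivity) ?_ (by positivity)
      rw [← div_eq_mul_inv, div_div]
      exact div_le_div_of_nonneg_left hd.le hL (by nlinarith)
    · refine max_le hfirst (Real.rpow_le_rpow (by positivity) ?_ (by positivity))
      have h1 := hone' h
      exact div_le_div_of_nonneg_left hd.le hL (by linarith)
  have hCp : C ^ p ≤ 1 - u / L := by
    have h := Real.rpow_le_rpow hC0 hCD hp0.le
    rwa [one_div, Real.rpow_inv_rpow (by positivity) hp0.ne', sub_div, div_self hL.ne'] at h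
  have huL0 : 0 < u / L := div_pos hu hL
  have hn1 : (1 : ℝ) ≤ n := by exact_mod_cast hn
  have hn0 : (0 : ℝ) < n := by linarith
  have hC1 : C ≤ 1 := by
    by_contra! h
    have := Real.one_lt_rpow h hp0
    linarith
  have hq0 : 0 ≤ (1 / q).toReal := ENNReal.toReal_nonneg
  have hnn : (0 : ℝ) ≤ (n : ℝ) ^ (-(1 / p + (1 / q).toReal)) := Real.rpow_nonneg hn0.le _
  have hnle : (n : ℝ) ^ (-(1 / p + (1 / q).toReal)) ≤ (n : ℝ) ^ (-(1 / p)) :=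
    Real.rpow_le_rpow_of_exponent_le hn1 (by linarith)
  have hnle1 : (n : ℝ) ^ (-(1 / p)) ≤ 1 :=
    Real.rpow_le_one_of_one_le_of_nonpos hn1 (by simp [hp0.le])
  refine le_secondBohrHol (fun z hz w hw => mem_lqBall_of_norm_eq hz hw) U
    (mul_nonneg hC0 hnn) (mul_le_one₀ hC1 hnn (hnle.trans hnle1)) hp0.le hlam0 hU0 hn ?_
  rw [hLdef, hudef]
  refine le_trans ?_ hCp
  calc (n : ℝ) * (C * (n : ℝ) ^ (-(1 / p + (1 / q).toReal))) ^ p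
      ≤ n * (C * (n : ℝ) ^ (-(1 / p))) ^ p := by gcongr
    _ = C ^ p := by
      rw [Real.mul_rpow hC0 (Real.rpow_nonneg hn0.le _), ← Real.rpow_mul hn0.le, neg_mul,
        one_div, inv_mul_cancel₀ hp0.ne', Real.rpow_neg_one]
      field_simp

end BohrPaper
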